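/- The discounted finite-horizon optimal control problem admits an optimal solution: there exists a measurable control α* : [0,t] → ℝⁿ with |α*(s)| ≤ M for all s such that the trajectory y*(s) = x + ∫₀ˢ α*(r) dr achieves the infimum u_λ(x,t) = inf_α ∫₀ᵗ (½|α(s)|² + f(y_x^α(s))) e^{-λs} ds over all measurable controls bounded by M. -/

import Mathlib

open MeasureTheory Real

open Filter Topology Set

/-- A bounded sequence in a separable Hilbert space has a weakly convergent subsequence. -/
lemma exists_weakly_convergent_subseq {H : Type*} [NormedAddCommGroup H] [InnerProductSpace ℝ H]
    [CompleteSpace H] [TopologicalSpace.SeparableSpace H] (u : ℕ → H) (R : ℝ)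
    (hu : ∀ k, ‖u k‖ ≤ R) :
    ∃ (v : H) (φ : ℕ → ℕ), StrictMono φ ∧
      ∀ w, Tendsto (fun k => inner ℝ (u (φ k)) w) atTop (𝓝 (inner ℝ v w)) := by
  obtain ⟨ℓ, -, φ, hφ, hlim⟩ :=
    WeakDual.isSeqCompact_closedBall ℝ H (0 : StrongDual ℝ H) R
      (x := fun k => StrongDual.toWeakDual (InnerProductSpace.toDual ℝ H (u k)))
      (fun k => by simpa using hu k)
  refine ⟨(InnerProductSpace.toDual ℝ H).symm (WeakDual.toStrongDual ℓ), φ, hφ, fun w => ?_⟩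
  rw [InnerProductSpace.toDual_symm_apply]
  exact (WeakDual.eval_continuous w).continuousAt.tendsto.comp hlim

section BoundedSequences

variable {X E : Type*} [MeasurableSpace X] {μ : Measure X}
  [NormedAddCommGroup E] [InnerProductSpace ℝ E]

lemma integrable_inner_of_memLp_two {a b : X → E} (ha : MemLp a 2 μ) (hb : MemLp b 2 μ) :
    Integrable (fun s => inner ℝ (a s) (b s)) μ :=
  (ha.norm.integrable_mul hb.norm).mono'
    (ha.aestronglyMeasurable.inner hb.aestronglyMeasurable)
    (ae_of_all _ fun _ => norm_inner_le_norm _ _)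

variable [IsFiniteMeasure μ] [MeasurableSpace E] [BorelSpace E]

/-- A weak `L²` limit of functions bounded by `M` is bounded by `M` almost everywhere. -/
lemma ae_norm_le_of_tendsto_integral_inner {a : ℕ → X → E} {b : X → E} {M : ℝ}
    (ha : ∀ k, MemLp (a k) 2 μ) (haM : ∀ k s, ‖a k s‖ ≤ M)
    (hb : MemLp b 2 μ) (hbm : Measurable b)
    (hlim : ∀ g : X → E, MemLp g 2 μ →
      Tendsto (fun k => ∫ s, inner ℝ (a k s) (g s) ∂μ) atTop
        (𝓝 (∫ s, inner ℝ (b s) (g s) ∂μ))) :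
    ∀ᵐ s ∂μ, ‖b s‖ ≤ M := by
  set A : Set X := {s | M < ‖b s‖}
  have hA : MeasurableSet A := measurableSet_lt measurable_const hbm.norm
  have hg : MemLp (A.indicator b) 2 μ := hb.indicator hA
  have hn : Integrable (fun s => M * ‖A.indicator b s‖) μ :=
    (hg.integrable one_le_two).norm.const_mul M
  have hi := integrable_inner_of_memLp_two hb hg
  have hle : ∫ s, inner ℝ (b s) (A.indicator b s) ∂μ ≤ ∫ s, M * ‖A.indicator b s‖ ∂μ :=
    le_of_tendsto (hlim _ hg) (.of_forall fun k =>
      integral_mono (integrable_inner_of_memLp_two (ha k) hg) hn fun s =>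
        (real_inner_le_norm _ _).trans
          (mul_le_mul_of_nonneg_right (haM k s) (norm_nonneg _)))
  have hnonneg : 0 ≤ fun s => inner ℝ (b s) (A.indicator b s) - M * ‖A.indicator b s‖ := by
    intro s
    by_cases hs : s ∈ A
    · have hs' : M < ‖b s‖ := hs
      simp only [hs, indicator_of_mem, real_inner_self_eq_norm_sq, Pi.zero_apply]
      nlinarith [norm_nonneg (b s)]
    · simp [hs]
  have hzero : ∫ s, (inner ℝ (b s) (A.indicator b s) - M * ‖A.indicator b s‖) ∂μ = 0 :=
    le_antisymm (by rw [integral_sub hi hn]; linarith) (integral_nonneg hnonneg)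
  rw [integral_eq_zero_iff_of_nonneg hnonneg (hi.sub hn)] at hzero
  filter_upwards [hzero] with s hs
  by_contra! hlt
  have hM : 0 ≤ M := (norm_nonneg _).trans (haM 0 s)
  have hsA : s ∈ A := hlt
  simp only [hsA, indicator_of_mem, real_inner_self_eq_norm_sq, Pi.zero_apply] at hs
  nlinarith

/-- Sequential weak compactness in `L²` of the set of functions bounded by `M`. -/
lemma exists_subseq_tendsto_integral_inner [CompleteSpace E] [SecondCountableTopology E]
    [MeasurableSpace.CountablyGenerated X] {a : ℕ → X → E} {M : ℝ} (hM : 0 ≤ M)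
    (ha : ∀ k, Measurable (a k)) (haM : ∀ k s, ‖a k s‖ ≤ M) :
    ∃ (b : X → E) (φ : ℕ → ℕ), StrictMono φ ∧ Measurable b ∧ (∀ s, ‖b s‖ ≤ M) ∧
      ∀ g : X → E, MemLp g 2 μ →
        Tendsto (fun k => ∫ s, inner ℝ (a (φ k) s) (g s) ∂μ) atTop
          (𝓝 (∫ s, inner ℝ (b s) (g s) ∂μ)) := by
  have ha2 : ∀ k, MemLp (a k) 2 μ := fun k =>
    MemLp.of_bound (ha k).aestronglyMeasurable M (ae_of_all _ (haM k))
  have : Fact ((2 : ENNReal) ≠ ⊤) := ⟨by simp⟩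
  obtain ⟨v, φ, hφ, hv⟩ := exists_weakly_convergent_subseq (fun k => (ha2 k).toLp (a k)) _
    (fun k => Lp.norm_le_of_ae_bound hM
      ((ha2 k).coeFn_toLp.mono fun s hs => by rw [hs]; exact haM k s))
  have hvm : Measurable v := (Lp.stronglyMeasurable v).measurable
  have hlim : ∀ g : X → E, MemLp g 2 μ →
      Tendsto (fun k => ∫ s, inner ℝ (a (φ k) s) (g s) ∂μ) atTop
        (𝓝 (∫ s, inner ℝ (v s) (g s) ∂μ)) := by
    intro g hg
    have h := hv (hg.toLp g)
    simp_rw [L2.inner_def] at h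
    refine (h.congr fun k => ?_).trans_eq ?_
    · refine integral_congr_ae ?_
      filter_upwards [(ha2 (φ k)).coeFn_toLp, hg.coeFn_toLp] with s h1 h2
      rw [h1, h2]
    · congr 1
      refine integral_congr_ae ?_
      filter_upwards [hg.coeFn_toLp] with s h2
      rw [h2]
  have hbound := ae_norm_le_of_tendsto_integral_inner (fun k => ha2 (φ k))
    (fun k => haM (φ k)) (Lp.memLp v) hvm hlim
  have hB : MeasurableSet {s | ‖v s‖ ≤ M} := measurableSet_le hvm.norm measurable_const
  refine ⟨indicator {s | ‖v s‖ ≤ M} v, φ, hφ, hvm.indicator hB, fun s => ?_, fun g hg => ?_⟩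
  · by_cases hs : ‖v s‖ ≤ M <;> simp [indicator, hs, hM]
  · have heq : ∫ s, inner ℝ (indicator {s | ‖v s‖ ≤ M} v s) (g s) ∂μ
        = ∫ s, inner ℝ (v s) (g s) ∂μ := by
      refine integral_congr_ae (hbound.mono fun s hs => ?_)
      simp [indicator, hs]
    rw [heq]
    exact hlim g hg

end BoundedSequences

lemma intervalIntegrable_of_measurable_of_norm_le {E : Type*} [NormedAddCommGroup E]
    [MeasurableSpace E] [BorelSpace E] [SecondCountableTopology E]
    {β : ℝ → E} {M : ℝ} (hβ : Measurable β) (hM : ∀ s, ‖β s‖ ≤ M)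
    (a b : ℝ) : IntervalIntegrable β volume a b :=
  (intervalIntegrable_const (c := M)).mono_fun hβ.aestronglyMeasurable
    (ae_of_all _ fun s => (hM s).trans (le_abs_self M))

/-- Weak `L²` convergence of controls gives pointwise convergence of their primitives. -/
lemma tendsto_primitive_of_tendsto_integral_inner {n : ℕ} {t : ℝ}
    {a : ℕ → ℝ → EuclideanSpace ℝ (Fin n)} {b : ℝ → EuclideanSpace ℝ (Fin n)} {M : ℝ}
    (ha : ∀ k, Measurable (a k)) (haM : ∀ k s, ‖a k s‖ ≤ M)
    (hb : Measurable b) (hbM : ∀ s, ‖b s‖ ≤ M)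
    (hlim : ∀ g : ℝ → EuclideanSpace ℝ (Fin n), MemLp g 2 (volume.restrict (Ioc 0 t)) →
      Tendsto (fun k => ∫ s in Ioc 0 t, inner ℝ (a k s) (g s)) atTop
        (𝓝 (∫ s in Ioc 0 t, inner ℝ (b s) (g s))))
    {s : ℝ} (hs : s ∈ Ioc 0 t) :
    Tendsto (fun k => ∫ r in (0:ℝ)..s, a k r) atTop (𝓝 (∫ r in (0:ℝ)..s, b r)) := by
  have key : ∀ (β : ℝ → EuclideanSpace ℝ (Fin n)), Measurable β → (∀ s, ‖β s‖ ≤ M) →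
      ∀ e, ∫ r in Ioc 0 t, inner ℝ (β r) ((Ioc 0 s).indicator (fun _ => e) r)
        = inner ℝ e (∫ r in (0:ℝ)..s, β r) := by
    intro β hβ hβM e
    have hint := intervalIntegrable_of_measurable_of_norm_le hβ hβM 0 s
    rw [intervalIntegrable_iff_integrableOn_Ioc_of_le hs.1.le] at hint
    rw [intervalIntegral.integral_of_le hs.1.le, ← integral_inner hint]
    have h1 : ∀ r, inner ℝ (β r) ((Ioc 0 s).indicator (fun _ => e) r)
        = (Ioc 0 s).indicator (fun r => inner ℝ e (β r)) r := fun r => by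
      by_cases hr : r ∈ Ioc 0 s <;> simp [hr, real_inner_comm]
    simp_rw [h1]
    rw [setIntegral_indicator measurableSet_Ioc,
      inter_eq_self_of_subset_right (Ioc_subset_Ioc_right hs.2)]
  have hcoord : ∀ e, Tendsto (fun k => inner ℝ e (∫ r in (0:ℝ)..s, a k r)) atTop
      (𝓝 (inner ℝ e (∫ r in (0:ℝ)..s, b r))) := by
    intro e
    have h := hlim ((Ioc 0 s).indicator fun _ => e) ((memLp_const e).indicator measurableSet_Ioc)
    rw [key b hb hbM e] at h
    exact h.congr fun k => key (a k) (ha k) (haM k) e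
  rw [(PiLp.homeomorph 2 (fun _ : Fin n => ℝ)).isInducing.tendsto_nhds_iff, tendsto_pi_nhds]
  intro i
  have h := hcoord (EuclideanSpace.single i 1)
  simp only [EuclideanSpace.inner_single_left, map_one, one_mul] at h
  exact h

/-- Existence of an optimal control for the discounted finite-horizon problem
with controls bounded by `M`. -/
theorem stmt_9 (n : ℕ) (f : EuclideanSpace ℝ (Fin n) → ℝ) (C : ℝ)
    (hf : Continuous f) (hC : ∀ x, |f x| ≤ C)
    (x : EuclideanSpace ℝ (Fin n)) (t lam M : ℝ)
    (ht : 0 < t) (hlam : 0 < lam) (hMpos : 0 < M) :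
    ∃ α : ℝ → EuclideanSpace ℝ (Fin n), Measurable α ∧ (∀ s, ‖α s‖ ≤ M) ∧
      (∫ s in (0:ℝ)..t,
          ((1/2) * ‖α s‖^2 + f (x + ∫ r in (0:ℝ)..s, α r)) * exp (-lam * s))
        = sInf {c : ℝ | ∃ β : ℝ → EuclideanSpace ℝ (Fin n),
            Measurable β ∧ (∀ s, ‖β s‖ ≤ M) ∧
            c = ∫ s in (0:ℝ)..t,
              ((1/2) * ‖β s‖^2 + f (x + ∫ r in (0:ℝ)..s, β r)) * exp (-lam * s)} := by
  set S : Set ℝ := {c : ℝ | ∃ β : ℝ → EuclideanSpace ℝ (Fin n),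
            Measurable β ∧ (∀ s, ‖β s‖ ≤ M) ∧
            c = ∫ s in (0:ℝ)..t,
              ((1/2) * ‖β s‖^2 + f (x + ∫ r in (0:ℝ)..s, β r)) * exp (-lam * s)}
  set w : ℝ → ℝ := fun s => exp (-lam * s)
  set μ : Measure ℝ := volume.restrict (Ioc 0 t) with hμ
  have hwm : Measurable w := by fun_prop
  have hw0 : ∀ s, 0 ≤ w s := fun s => (exp_pos _).le
  have hw1 : ∀ᵐ s ∂μ, w s ≤ 1 := by
    filter_upwards [ae_restrict_mem measurableSet_Ioc] with s hs
    exact exp_le_one_iff.mpr (by nlinarith [hs.1])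
  have hC0 : 0 ≤ C := (abs_nonneg _).trans (hC 0)
  have hrun_meas : ∀ β : ℝ → EuclideanSpace ℝ (Fin n), Measurable β → (∀ s, ‖β s‖ ≤ M) →
      Measurable fun s => f (x + ∫ r in (0:ℝ)..s, β r) := fun β hβ hβM =>
    (hf.comp (continuous_const.add (intervalIntegral.continuous_primitive
      (intervalIntegrable_of_measurable_of_norm_le hβ hβM) 0))).measurable
  have hrun_bound : ∀ β : ℝ → EuclideanSpace ℝ (Fin n),
      ∀ᵐ s ∂μ, ‖f (x + ∫ r in (0:ℝ)..s, β r) * w s‖ ≤ C := by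
    intro β
    filter_upwards [hw1] with s hs
    rw [norm_mul, norm_eq_abs, norm_of_nonneg (hw0 s)]
    simpa using mul_le_mul (hC _) hs (hw0 s) hC0
  have hrun_int : ∀ β : ℝ → EuclideanSpace ℝ (Fin n), Measurable β → (∀ s, ‖β s‖ ≤ M) →
      Integrable (fun s => f (x + ∫ r in (0:ℝ)..s, β r) * w s) μ := fun β hβ hβM =>
    Integrable.of_bound ((hrun_meas β hβ hβM).mul hwm).aestronglyMeasurable C (hrun_bound β)
  have hkin_int : ∀ β : ℝ → EuclideanSpace ℝ (Fin n), Measurable β → (∀ s, ‖β s‖ ≤ M) →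
      Integrable (fun s => (1/2) * ‖β s‖^2 * w s) μ := by
    intro β hβ hβM
    refine Integrable.of_bound (((hβ.norm.pow_const 2).const_mul _).mul hwm).aestronglyMeasurable
      (1/2 * M^2) ?_
    filter_upwards [hw1] with s hs
    have h1 : (1/2) * ‖β s‖^2 ≤ 1/2 * M^2 := by gcongr; exact hβM s
    rw [norm_of_nonneg (mul_nonneg (by positivity) (hw0 s))]
    simpa using mul_le_mul h1 hs (hw0 s) (by positivity)
  have hcost : ∀ β : ℝ → EuclideanSpace ℝ (Fin n), Measurable β → (∀ s, ‖β s‖ ≤ M) →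
      (∫ s in (0:ℝ)..t, ((1/2) * ‖β s‖^2 + f (x + ∫ r in (0:ℝ)..s, β r)) * w s)
        = (∫ s, (1/2) * ‖β s‖^2 * w s ∂μ) + ∫ s, f (x + ∫ r in (0:ℝ)..s, β r) * w s ∂μ := by
    intro β hβ hβM
    rw [intervalIntegral.integral_of_le ht.le,
      ← integral_add (hkin_int β hβ hβM) (hrun_int β hβ hβM)]
    simp_rw [add_mul, hμ]
  have hbdd : BddBelow S := by
    refine ⟨-(C * μ.real univ), ?_⟩
    rintro c ⟨β, hβ, hβM, rfl⟩
    rw [hcost β hβ hβM]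
    have h1 : 0 ≤ ∫ s, (1/2) * ‖β s‖^2 * w s ∂μ :=
      integral_nonneg fun s => mul_nonneg (by positivity) (hw0 s)
    have h2 := norm_integral_le_of_norm_le_const (hrun_bound β)
    rw [norm_eq_abs] at h2
    linarith [(abs_le.mp h2).1]
  have hne : S.Nonempty := ⟨_, fun _ => 0, measurable_const, by simp [hMpos.le], rfl⟩
  obtain ⟨c, -, hc, hcS⟩ := exists_seq_tendsto_sInf hne hbdd
  choose a ha haM hca using hcS
  obtain ⟨α, φ, hφ, hα, hαM, hlim⟩ :=
    exists_subseq_tendsto_integral_inner (μ := μ) hMpos.le ha haM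
  refine ⟨α, hα, hαM, le_antisymm ?_ (csInf_le hbdd ⟨α, hα, hαM, rfl⟩)⟩
  have hg : MemLp (fun s => w s • α s) 2 μ := by
    refine MemLp.of_bound (hwm.smul hα).aestronglyMeasurable M ?_
    filter_upwards [hw1] with s hs
    rw [norm_smul, norm_of_nonneg (hw0 s)]
    simpa using mul_le_mul hs (hαM s) (norm_nonneg _) zero_le_one
  have hself : ∫ s, inner ℝ (α s) (w s • α s) ∂μ = 2 * ∫ s, (1/2) * ‖α s‖^2 * w s ∂μ := by
    rw [← integral_const_mul]
    congr 1 with s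
    rw [real_inner_smul_right, real_inner_self_eq_norm_sq]
    ring
  have hkin_lim := (hlim _ hg).sub_const (∫ s, (1/2) * ‖α s‖^2 * w s ∂μ)
  have hrun_lim : Tendsto (fun k => ∫ s, f (x + ∫ r in (0:ℝ)..s, a (φ k) r) * w s ∂μ) atTop
      (𝓝 (∫ s, f (x + ∫ r in (0:ℝ)..s, α r) * w s ∂μ)) := by
    refine tendsto_integral_of_dominated_convergence (fun _ => C)
      (fun k => (hrun_int _ (ha _) (haM _)).aestronglyMeasurable) (integrable_const C)
      (fun k => hrun_bound _) ?_
    filter_upwards [ae_restrict_mem measurableSet_Ioc] with s hs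
    exact ((hf.tendsto _).comp ((tendsto_primitive_of_tendsto_integral_inner
      (fun k => ha (φ k)) (fun k => haM (φ k)) hα hαM hlim hs).const_add x)).mul_const _
  have hle := le_of_tendsto_of_tendsto' (hkin_lim.add hrun_lim) (hc.comp hφ.tendsto_atTop)
    fun k => by
      simp only [Function.comp_apply]
      rw [hca, hcost _ (ha _) (haM _)]
      have ha2 : MemLp (a (φ k)) 2 μ :=
        MemLp.of_bound (ha _).aestronglyMeasurable M (ae_of_all _ (haM _))
      have hi := integrable_inner_of_memLp_two ha2 hg
      gcongr
      rw [← integral_sub hi (hkin_int α hα hαM)]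
      refine integral_mono (hi.sub (hkin_int α hα hαM)) (hkin_int _ (ha _) (haM _)) fun s => ?_
      simp only [real_inner_smul_right]
      have hsq := mul_nonneg (hw0 s) (sq_nonneg ‖a (φ k) s - α s‖)
      rw [norm_sub_sq_real] at hsq
      linarith
  rw [hself] at hle
  rw [hcost α hα hαM]
  linarith
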